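/- Suppose f : E → ℝ is locally Lipschitz and is a strong C² max function at x̄ with data f₁, …, f_n (so that x̄ is a local minimizer of f). Then there exist constants μ > 0, C > 0, δ > 0 and ε̄ > 0 with the following property: for every point x with ‖x − x̄‖ ≤ δ and every radius ε ∈ [0, ε̄], if the Goldstein subgradient satisfies ‖g_ε(x)‖ ≤ μ, then the distance from x to the active manifold M satisfies dist(x, M) ≤ C·ε, and for every nearest point y ∈ M of x (i.e. y ∈ M with ‖x − y‖ = dist(x, M)) one has ‖g_ε(x) − p(y)‖ ≤ C·ε. -/

import Mathlib

open Filter Topology Metric Set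
open scoped Classical

variable {E : Type*} [NormedAddCommGroup E] [InnerProductSpace ℝ E] [FiniteDimensional ℝ E]

/-- The Clarke subdifferential: the closed convex hull of all limits of gradients
along sequences of points of differentiability converging to `x`. -/
noncomputable def clarkeSubdiff (f : E → ℝ) (x : E) : Set E :=
  closure (convexHull ℝ {v : E | ∃ u : ℕ → E,
    (∀ n, DifferentiableAt ℝ f (u n)) ∧
    Tendsto u atTop (𝓝 x) ∧
    Tendsto (fun n => gradient f (u n)) atTop (𝓝 v)})

/-- The Goldstein subdifferential of radius `ε`. -/
noncomputable def goldsteinSubdiff (f : E → ℝ) (x : E) (ε : ℝ) : Set E :=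
  convexHull ℝ (⋃ y ∈ Metric.closedBall x ε, clarkeSubdiff f y)

/-- The element of minimal norm of a set (junk value `0` if no minimizer exists). -/
noncomputable def minNorm (s : Set E) : E :=
  if h : ∃ v, v ∈ s ∧ ∀ w ∈ s, ‖v‖ ≤ ‖w‖ then h.choose else 0

/-- The Goldstein subgradient: the minimal-norm element of the Goldstein subdifferential. -/
noncomputable def goldsteinGrad (f : E → ℝ) (x : E) (ε : ℝ) : E :=
  minNorm (goldsteinSubdiff f x ε)

/-- The Goldstein modulus `Γf(x) = inf {ε ≥ 0 : ‖g_ε(x)‖ ≤ ε}`. -/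
noncomputable def goldsteinModulus (f : E → ℝ) (x : E) : ℝ :=
  sInf {ε : ℝ | 0 ≤ ε ∧ ‖goldsteinGrad f x ε‖ ≤ ε}

open scoped RealInnerProductSpace

/-- `f` is a strong `C²` max function at `xbar` with data `F 0, …, F n`. -/
def IsStrongC2MaxAt (f : E → ℝ) (xbar : E) {n : ℕ} (F : Fin (n + 1) → E → ℝ) : Prop :=
  (∀ i, ContDiff ℝ 2 (F i)) ∧
  (∃ ρ > 0, ∀ x : E, ‖x - xbar‖ ≤ ρ →
      f x = Finset.univ.sup' Finset.univ_nonempty (fun i => F i x)) ∧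
  (∀ i j, F i xbar = F j xbar) ∧
  AffineIndependent ℝ (fun i => gradient (F i) xbar) ∧
  (0 : E) ∈ intrinsicInterior ℝ (convexHull ℝ (Set.range fun i => gradient (F i) xbar)) ∧
  (∃ δ > 0, ∃ ρ' > 0, ∀ x : E, ‖x - xbar‖ ≤ ρ' → f x - f xbar ≥ δ / 2 * ‖x - xbar‖ ^ 2)

section Weights

variable {V : Type*} [NormedAddCommGroup V] [InnerProductSpace ℝ V] {ι : Type*} [Fintype ι]

lemma AffineIndependent.exists_le_norm_sum_smul {w : ι → V} (hw : AffineIndependent ℝ w) :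
    ∃ c > 0, ∀ a : ι → ℝ, ∑ i, a i = 0 → c * ∑ i, |a i| ≤ ‖∑ i, a i • w i‖ := by
  let T : (ι → ℝ) →ₗ[ℝ] V × ℝ :=
    (Fintype.linearCombination ℝ w).prod (Fintype.linearCombination ℝ fun _ => (1 : ℝ))
  have hT : ∀ a, T a = (∑ i, a i • w i, ∑ i, a i) := fun a => by
    simp [T, Fintype.linearCombination_apply]
  have hker : LinearMap.ker T = ⊥ := by
    rw [LinearMap.ker_eq_bot']
    intro a ha
    rw [hT, Prod.mk_eq_zero] at ha
    funext i
    exact (affineIndependent_iff.1 hw) Finset.univ a ha.2 ha.1 i (Finset.mem_univ i)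
  obtain ⟨K, hK, hKT⟩ := T.exists_antilipschitzWith hker
  have hN : (0 : ℝ) < (Fintype.card ι + 1) * K := by positivity
  refine ⟨((Fintype.card ι + 1) * K)⁻¹, by positivity, fun a ha => ?_⟩
  rw [inv_mul_le_iff₀ hN]
  have h1 : ‖a‖ ≤ K * ‖∑ i, a i • w i‖ := by
    have := hKT.le_mul_dist a 0
    rw [map_zero, dist_zero_right, dist_zero_right, hT, ha, Prod.norm_def] at this
    simpa using this
  have h2 : ∑ i, |a i| ≤ Fintype.card ι * ‖a‖ := by
    have : ∑ i, |a i| ≤ ∑ _i : ι, ‖a‖ := Finset.sum_le_sum fun i _ => norm_le_pi_norm a i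
    simpa using this
  have : (0 : ℝ) ≤ K * ‖∑ i, a i • w i‖ := by positivity
  nlinarith [mul_le_mul_of_nonneg_left h1 (Nat.cast_nonneg (α := ℝ) (Fintype.card ι))]

lemma norm_sum_smul_le_mul_sum_abs {e : ι → V} {η : ℝ} (he : ∀ i, ‖e i‖ ≤ η) (a : ι → ℝ) :
    ‖∑ i, a i • e i‖ ≤ η * ∑ i, |a i| := by
  rw [Finset.mul_sum]
  refine norm_sum_le_of_le _ fun i _ => ?_
  rw [norm_smul, Real.norm_eq_abs, mul_comm]
  exact mul_le_mul_of_nonneg_right (he i) (abs_nonneg _)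

lemma le_norm_sum_smul_of_norm_sub_le {w w' : ι → V} {c η : ℝ}
    (hw : ∀ a : ι → ℝ, ∑ i, a i = 0 → c * ∑ i, |a i| ≤ ‖∑ i, a i • w i‖)
    (hη : ∀ i, ‖w' i - w i‖ ≤ η) (a : ι → ℝ) (ha : ∑ i, a i = 0) :
    (c - η) * ∑ i, |a i| ≤ ‖∑ i, a i • w' i‖ := by
  have h1 := norm_sum_smul_le_mul_sum_abs hη a
  have h2 : ∑ i, a i • w i = ∑ i, a i • w' i - ∑ i, a i • (w' i - w i) := by
    rw [← Finset.sum_sub_distrib]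
    exact Finset.sum_congr rfl fun i _ => by module
  have h3 := hw a ha
  have h4 := norm_sub_le (∑ i, a i • w' i) (∑ i, a i • (w' i - w i))
  rw [h2] at h3
  linarith

/-- If a convex combination with positive weights of `w` vanishes, then affine combinations of
nearby points in which some weight vanishes are bounded away from zero. -/
lemma le_norm_sum_smul_of_weight_eq_zero {w w' : ι → V} {c η : ℝ} {l m : ι → ℝ} {j : ι}
    (hw : ∀ a : ι → ℝ, ∑ i, a i = 0 → c * ∑ i, |a i| ≤ ‖∑ i, a i • w i‖)
    (hη : ∀ i, ‖w' i - w i‖ ≤ η) (hcη : η ≤ c)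
    (hl0 : ∀ i, 0 ≤ l i) (hl1 : ∑ i, l i = 1) (hlw : ∑ i, l i • w i = 0)
    (hm1 : ∑ i, m i = 1) (hmj : m j = 0) :
    (c - η) * l j - η ≤ ‖∑ i, m i • w' i‖ := by
  have h1 := le_norm_sum_smul_of_norm_sub_le hw hη (fun i => m i - l i)
    (by rw [Finset.sum_sub_distrib, hm1, hl1, sub_self])
  have h2 : l j ≤ ∑ i, |m i - l i| := by
    have := Finset.single_le_sum (f := fun i => |m i - l i|) (fun i _ => abs_nonneg _)
      (Finset.mem_univ j)
    simp only [hmj, zero_sub, abs_neg, abs_of_nonneg (hl0 j)] at this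
    exact this
  have h3 : ∑ i, (m i - l i) • w' i = ∑ i, m i • w' i - ∑ i, l i • (w' i - w i) := by
    simp only [sub_smul, smul_sub, Finset.sum_sub_distrib, hlw, sub_zero]
  have h4 := norm_sum_smul_le_mul_sum_abs hη l
  simp only [abs_of_nonneg (hl0 _), hl1, mul_one] at h4
  have h5 := norm_sub_le (∑ i, m i • w' i) (∑ i, l i • (w' i - w i))
  rw [← h3] at h5
  have h6 := mul_le_mul_of_nonneg_left h2 (sub_nonneg.2 hcη)
  linarith

/-- The projection of the origin onto an affine hull is a Lipschitz function of the
affinely independent generators. -/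
lemma norm_sub_le_of_inner_eq {u w : ι → V} {c η : ℝ} (hc : 0 < c) {l m : ι → ℝ} {p g : V}
    (hw : ∀ a : ι → ℝ, ∑ i, a i = 0 → c * ∑ i, |a i| ≤ ‖∑ i, a i • w i‖)
    (hη : ∀ i, ‖u i - w i‖ ≤ η) (hη0 : 0 ≤ η) (hl1 : ∑ i, l i = 1)
    (hm0 : ∀ i, 0 ≤ m i) (hm1 : ∑ i, m i = 1)
    (hg : ∑ i, m i • u i = g) (hp : ∑ i, l i • w i = p)
    (hgu : ∀ i, ⟪g, u i⟫ = ‖g‖ ^ 2) (hpw : ∀ i, ⟪p, w i⟫ = ‖p‖ ^ 2) :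
    ‖g - p‖ ≤ (2 + ‖g‖ / c) * η := by
  set r := ∑ i, (m i - l i) • w i with hr
  set e := ∑ i, m i • (u i - w i) with he
  have hsum : ∑ i, (m i - l i) = 0 := by rw [Finset.sum_sub_distrib, hm1, hl1, sub_self]
  have hgp : g - p = e + r := by
    rw [he, hr, ← Finset.sum_add_distrib, ← hg, ← hp, ← Finset.sum_sub_distrib]
    exact Finset.sum_congr rfl fun i _ => by module
  have heη : ‖e‖ ≤ η := by
    have := norm_sum_smul_le_mul_sum_abs hη m
    simpa only [abs_of_nonneg (hm0 _), hm1, mul_one] using this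
  have hpr : ⟪p, r⟫ = 0 := by
    simp only [hr, inner_sum, inner_smul_right, hpw, ← Finset.sum_mul, hsum, zero_mul]
  have hgr : ⟪g, r⟫ = -⟪g, ∑ i, (m i - l i) • (u i - w i)⟫ := by
    have h0 : ⟪g, ∑ i, (m i - l i) • u i⟫ = 0 := by
      simp only [inner_sum, inner_smul_right, hgu, ← Finset.sum_mul, hsum, zero_mul]
    have : r = ∑ i, (m i - l i) • u i - ∑ i, (m i - l i) • (u i - w i) := by
      rw [hr, ← Finset.sum_sub_distrib]
      exact Finset.sum_congr rfl fun i _ => by module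
    rw [this, inner_sub_right, h0, zero_sub]
  have h1 : ⟪g, r⟫ ≤ ‖g‖ * (η * (‖r‖ / c)) := by
    rw [hgr]
    refine (neg_le_abs _).trans ((abs_real_inner_le_norm _ _).trans ?_)
    refine mul_le_mul_of_nonneg_left ?_ (norm_nonneg _)
    refine (norm_sum_smul_le_mul_sum_abs hη _).trans (mul_le_mul_of_nonneg_left ?_ hη0)
    rw [le_div_iff₀ hc, mul_comm]
    exact hw _ hsum
  have h2 : ‖r‖ ^ 2 = ⟪g, r⟫ - ⟪e, r⟫ := by
    have : r = g - p - e := by rw [hgp]; abel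
    rw [← real_inner_self_eq_norm_sq]
    nth_rw 1 [this]
    rw [inner_sub_left, inner_sub_left, hpr, sub_zero]
  have h3 : -⟪e, r⟫ ≤ η * ‖r‖ :=
    (neg_le_abs _).trans ((abs_real_inner_le_norm _ _).trans
      (mul_le_mul_of_nonneg_right heη (norm_nonneg _)))
  have h4 : ‖r‖ ≤ (1 + ‖g‖ / c) * η := by
    rcases (norm_nonneg r).eq_or_lt with h | h
    · rw [← h]; positivity
    · refine le_of_mul_le_mul_right ?_ h
      calc ‖r‖ * ‖r‖ = ⟪g, r⟫ - ⟪e, r⟫ := by rw [← h2, sq]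
        _ ≤ ‖g‖ * (η * (‖r‖ / c)) + η * ‖r‖ := by linarith
        _ = (1 + ‖g‖ / c) * η * ‖r‖ := by ring
  rw [hgp]
  refine (norm_add_le _ _).trans ?_
  linarith

/-- A point of minimal norm of a convex set which is a positive combination of points of the set
has the same inner product with each of them. -/
lemma inner_eq_of_norm_le {s : Set V} (hs : Convex ℝ s) {g : V} (hg : g ∈ s)
    (hmin : ∀ v ∈ s, ‖g‖ ≤ ‖v‖) {u : ι → V} (hu : ∀ i, u i ∈ s) {m : ι → ℝ}
    (hm0 : ∀ i, 0 < m i) (hm1 : ∑ i, m i = 1) (hgu : ∑ i, m i • u i = g) (i : ι) :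
    ⟪g, u i⟫ = ‖g‖ ^ 2 := by
  have key : ∀ v ∈ s, ‖g‖ ^ 2 ≤ ⟪g, v⟫ := by
    have : Nonempty s := ⟨⟨g, hg⟩⟩
    have h := (norm_eq_iInf_iff_real_inner_le_zero hs (u := 0) hg).1 (by
      refine le_antisymm (le_ciInf fun v => ?_)
        (ciInf_le ⟨0, by rintro _ ⟨v, rfl⟩; positivity⟩ (⟨g, hg⟩ : s))
      simpa using hmin v v.2)
    intro v hv
    have := h v hv
    rw [zero_sub, inner_neg_left, inner_sub_right, real_inner_self_eq_norm_sq] at this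
    linarith
  have hsum : ∑ j, m j * (⟪g, u j⟫ - ‖g‖ ^ 2) = 0 := by
    have : ∑ j, m j * ⟪g, u j⟫ = ‖g‖ ^ 2 := by
      rw [← real_inner_self_eq_norm_sq]
      nth_rw 3 [← hgu]
      simp only [inner_sum, inner_smul_right]
    simp only [mul_sub, Finset.sum_sub_distrib, this, ← Finset.sum_mul, hm1, one_mul, sub_self]
  have h0 := (Finset.sum_eq_zero_iff_of_nonneg fun j _ =>
    mul_nonneg (hm0 j).le (sub_nonneg.2 (key _ (hu j)))).1 hsum i (Finset.mem_univ i)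
  exact sub_eq_zero.1 ((mul_eq_zero.1 h0).resolve_left (hm0 i).ne')

lemma exists_weights_of_mem_convexHull_iUnion {T : ι → Set V} {x : V}
    (hx : x ∈ convexHull ℝ (⋃ i, T i)) :
    ∃ (m : ι → ℝ) (u : ι → V), (∀ i, 0 ≤ m i) ∧ ∑ i, m i = 1 ∧
      (∀ i, 0 < m i → u i ∈ convexHull ℝ (T i)) ∧ ∑ i, m i • u i = x := by
  obtain ⟨κ, _, a, z, ha0, ha1, hz, rfl⟩ := mem_convexHull_iff_exists_fintype.1 hx
  choose φ hφ using fun k => mem_iUnion.1 (hz k)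
  let t : ι → Finset κ := fun i => Finset.univ.filter fun k => φ k = i
  refine ⟨fun i => ∑ k ∈ t i, a k, fun i => (t i).centerMass a z,
    fun i => Finset.sum_nonneg fun k _ => ha0 k, ?_, fun i hi => ?_, ?_⟩
  · rw [← ha1]
    exact Finset.sum_fiberwise _ _ _
  · refine Finset.centerMass_mem_convexHull _ (fun k _ => ha0 k) hi fun k hk => ?_
    rw [← (Finset.mem_filter.1 hk).2]
    exact hφ k
  · rw [← Finset.sum_fiberwise Finset.univ φ fun k => a k • z k]
    refine Finset.sum_congr rfl fun i _ => ?_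
    change (∑ k ∈ t i, a k) • ((∑ k ∈ t i, a k)⁻¹ • ∑ k ∈ t i, a k • z k) = _
    by_cases h : ∑ k ∈ t i, a k = 0
    · rw [h, zero_smul, eq_comm]
      refine Finset.sum_eq_zero fun k hk => ?_
      rw [(Finset.sum_eq_zero_iff_of_nonneg fun k _ => ha0 k).1 h k hk, zero_smul]
    · rw [smul_inv_smul₀ h]

lemma mem_convexHull_range_iff {w : ι → V} {x : V} :
    x ∈ convexHull ℝ (range w) ↔
      ∃ a : ι → ℝ, (∀ i, 0 ≤ a i) ∧ ∑ i, a i = 1 ∧ ∑ i, a i • w i = x := by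
  constructor
  · intro hx
    rw [← iUnion_singleton_eq_range] at hx
    obtain ⟨a, u, ha0, ha1, hu, rfl⟩ := exists_weights_of_mem_convexHull_iUnion hx
    refine ⟨a, ha0, ha1, Finset.sum_congr rfl fun i _ => ?_⟩
    rcases (ha0 i).eq_or_lt with h | h
    · rw [← h, zero_smul, zero_smul]
    · have := hu i h
      rw [convexHull_singleton, mem_singleton_iff] at this
      rw [this]
  · rintro ⟨a, h0, h1, rfl⟩
    exact (convex_convexHull ℝ _).sum_mem (fun i _ => h0 i) h1
      fun i _ => subset_convexHull ℝ _ (mem_range_self i)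

lemma exists_pos_weights_of_mem_intrinsicInterior [Nonempty ι] {w : ι → V} {x : V}
    (hx : x ∈ intrinsicInterior ℝ (convexHull ℝ (range w))) :
    ∃ l : ι → ℝ, (∀ i, 0 < l i) ∧ ∑ i, l i = 1 ∧ ∑ i, l i • w i = x := by
  set N : ℝ := (Fintype.card ι : ℝ) with hN
  have hN0 : 0 < N := by rw [hN]; exact_mod_cast Fintype.card_pos
  set b : V := ∑ i, N⁻¹ • w i with hb
  have hbm : b ∈ convexHull ℝ (range w) :=
    mem_convexHull_range_iff.2 ⟨fun _ => N⁻¹, fun _ => by positivity,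
      by simp [← hN, hN0.ne'], rfl⟩
  have hxm := intrinsicInterior_subset hx
  obtain ⟨y, hy, rfl⟩ := mem_intrinsicInterior.1 hx
  have hba := subset_affineSpan ℝ _ hbm
  let γ : ℝ → affineSpan ℝ (convexHull ℝ (range w)) := fun t =>
    ⟨AffineMap.lineMap (y : V) b t, AffineMap.lineMap_mem t y.2 hba⟩
  have hγ : Continuous γ := by
    refine Continuous.subtype_mk ?_ _
    exact AffineMap.lineMap_continuous
  have h0 : γ 0 = y := by ext; simp [γ]
  have hev : ∀ᶠ t in 𝓝 (0 : ℝ), γ t ∈ interior ((↑) ⁻¹' convexHull ℝ (range w)) :=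
    hγ.continuousAt.eventually_mem (by rw [h0]; exact isOpen_interior.mem_nhds hy)
  obtain ⟨t, ht, ht0⟩ := ((hev.filter_mono nhdsWithin_le_nhds).and
    (self_mem_nhdsWithin (s := Iio (0 : ℝ)))).exists
  obtain ⟨a, ha0, ha1, hay⟩ := mem_convexHull_range_iff.1
    (show (γ t : V) ∈ convexHull ℝ (range w) from interior_subset (s := Subtype.val ⁻¹' _) ht)
  have ht0' : t < 0 := ht0
  have h1t : 0 < 1 - t := by linarith
  refine ⟨fun i => (a i + -t * N⁻¹) / (1 - t), fun i => ?_, ?_, ?_⟩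
  · have := ha0 i
    have : 0 < -t * N⁻¹ := mul_pos (by linarith) (by positivity)
    exact div_pos (by linarith) h1t
  · rw [← Finset.sum_div, Finset.sum_add_distrib, ha1, Finset.sum_const, Finset.card_univ,
      nsmul_eq_mul, ← hN, div_eq_one_iff_eq h1t.ne']
    field_simp
    ring
  · have : ∀ i, ((a i + -t * N⁻¹) / (1 - t)) • w i
        = (1 - t)⁻¹ • (a i • w i - t • (N⁻¹ • w i)) := fun i => by
      rw [div_eq_inv_mul, mul_smul]; congr 1; module
    simp only [this]
    rw [← Finset.smul_sum, Finset.sum_sub_distrib, hay, ← Finset.smul_sum, ← hb]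
    simp only [γ, AffineMap.lineMap_apply_module]
    rw [inv_smul_eq_iff₀ h1t.ne']
    module

end Weights

section Compactness

lemma minNorm_spec {V : Type*} [NormedAddCommGroup V] {s : Set V} (hs : IsCompact s) (hne : s.Nonempty) :
    minNorm s ∈ s ∧ ∀ w ∈ s, ‖minNorm s‖ ≤ ‖w‖ := by
  have h : ∃ v, v ∈ s ∧ ∀ w ∈ s, ‖v‖ ≤ ‖w‖ := by
    obtain ⟨v, hv, hmin⟩ := hs.exists_isMinOn hne continuous_norm.continuousOn
    exact ⟨v, hv, fun w hw => hmin hw⟩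
  rw [minNorm, dif_pos h]
  exact h.choose_spec

/-- The convex hull of a compact set in a finite-dimensional space is compact. -/
lemma IsCompact.convexHull_of_finiteDimensional {s : Set E} (hs : IsCompact s) :
    IsCompact (convexHull ℝ s) := by
  let Φ : (k : ℕ) → (Fin k → ℝ) × (Fin k → E) → E := fun k q => ∑ i, q.1 i • q.2 i
  have hΦ : ∀ k, Continuous (Φ k) := fun k => by fun_prop
  have heq : convexHull ℝ s = ⋃ k ∈ Finset.range (Module.finrank ℝ E + 2),
      Φ k '' (stdSimplex ℝ (Fin k) ×ˢ Set.pi univ fun _ => s) := by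
    refine Subset.antisymm (fun x hx => ?_) (iUnion₂_subset fun k _ => ?_)
    · obtain ⟨ι, _, z, w, hz, hind, hw0, hw1, rfl⟩ := eq_pos_convex_span_of_mem_convexHull hx
      have hcard : Fintype.card ι ≤ Module.finrank ℝ E + 1 :=
        hind.card_le_finrank_succ.trans
          (Nat.succ_le_succ (Submodule.finrank_le _))
      refine mem_iUnion₂.2 ⟨Fintype.card ι, Finset.mem_range.2 (by omega), ?_⟩
      let e := (Fintype.equivFin ι).symm
      refine ⟨(w ∘ e, z ∘ e), ⟨⟨fun i => (hw0 _).le, ?_⟩, fun i _ => hz (mem_range_self _)⟩, ?_⟩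
      · exact (e.sum_comp w).trans hw1
      · exact e.sum_comp fun i => w i • z i
    · rintro _ ⟨⟨w, z⟩, ⟨hw, hz⟩, rfl⟩
      exact mem_convexHull_of_exists_fintype w z hw.1 hw.2 (fun i => hz i (mem_univ i)) rfl
  rw [heq]
  exact Finset.isCompact_biUnion _ fun k _ =>
    ((isCompact_stdSimplex ℝ (Fin k)).prod (isCompact_univ_pi fun _ => hs)).image (hΦ k)

end Compactness

section LimitingGradients

/-- The limits of gradients of `f` along sequences converging to `x`. -/
def limitingGradients (f : E → ℝ) (x : E) : Set E :=
  {v : E | ∃ u : ℕ → E, (∀ n, DifferentiableAt ℝ f (u n)) ∧ Tendsto u atTop (𝓝 x) ∧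
    Tendsto (fun n => gradient f (u n)) atTop (𝓝 v)}

lemma mem_limitingGradients_iff {f : E → ℝ} {x v : E} :
    v ∈ limitingGradients f x ↔
      (x, v) ∈ closure ((fun u => (u, gradient f u)) '' {u | DifferentiableAt ℝ f u}) := by
  rw [mem_closure_iff_seq_limit]
  constructor
  · rintro ⟨u, hu, hux, huv⟩
    exact ⟨fun n => (u n, gradient f (u n)), fun n => ⟨u n, hu n, rfl⟩, hux.prodMk_nhds huv⟩
  · rintro ⟨q, hq, hlim⟩
    choose u hu hqu using hq
    have h := (Prod.tendsto_iff _ _).1 hlim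
    simp only [← hqu] at h
    exact ⟨u, hu, h.1, h.2⟩

/-- A locally Lipschitz function is differentiable on a dense set. -/
lemma LocallyLipschitz.dense_differentiableAt {f : E → ℝ} (hf : LocallyLipschitz f) :
    Dense {x | DifferentiableAt ℝ f x} := by
  let _ : MeasurableSpace E := borel E
  have _ : BorelSpace E := ⟨rfl⟩
  refine dense_iff_inter_open.2 fun U hU ⟨x, hx⟩ => ?_
  obtain ⟨K, t, ht, hK⟩ := hf x
  obtain ⟨W, hWt, hW, hxW⟩ := _root_.mem_nhds_iff.1 (Filter.inter_mem ht (hU.mem_nhds hx))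
  have hae := (hK.mono (hWt.trans inter_subset_left)).ae_differentiableWithinAt_of_mem
    (μ := MeasureTheory.Measure.addHaar)
  have hpos := hW.measure_pos MeasureTheory.Measure.addHaar ⟨x, hxW⟩
  by_contra hcon
  refine hpos.ne' (MeasureTheory.measure_mono_null (fun y hy => ?_)
    (MeasureTheory.ae_iff.1 hae))
  intro hd
  exact hcon ⟨y, (hWt hy).2, (hd hy).differentiableAt (hW.mem_nhds hy)⟩

lemma gradient_eq_of_eventuallyLE {f g : E → ℝ} {u : E} (hf : DifferentiableAt ℝ f u)
    (hg : DifferentiableAt ℝ g u) (hle : ∀ᶠ z in 𝓝 u, g z ≤ f z) (heq : g u = f u) :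
    gradient f u = gradient g u := by
  have hmin : IsLocalMin (fun z => f z - g z) u := by
    filter_upwards [hle] with z hz
    rw [heq, sub_self]
    exact sub_nonneg.2 hz
  have h := hmin.fderiv_eq_zero
  rw [fderiv_fun_sub hf hg, sub_eq_zero] at h
  rw [gradient, gradient, h]

variable {ι : Type*} [Fintype ι] {f : E → ℝ} {F : ι → E → ℝ} {xbar x v : E} {ρ : ℝ}

lemma continuous_gradient {g : E → ℝ} (hg : ContDiff ℝ 2 g) : Continuous (gradient g) :=
  (InnerProductSpace.toDual ℝ E).symm.continuous.comp (hg.continuous_fderiv (by norm_num))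

lemma exists_subseq_gradient_eq (hF : ∀ i, ContDiff ℝ 2 (F i))
    (hle : ∀ z ∈ closedBall xbar ρ, ∀ i, F i z ≤ f z)
    (hact : ∀ z ∈ closedBall xbar ρ, ∃ i, F i z = f z) (hx : x ∈ ball xbar ρ) {u : ℕ → E}
    (hu : ∀ n, DifferentiableAt ℝ f (u n)) (hux : Tendsto u atTop (𝓝 x)) :
    ∃ i, ∃ ψ : ℕ → ℕ, StrictMono ψ ∧
      ∀ n, F i (u (ψ n)) = f (u (ψ n)) ∧ gradient f (u (ψ n)) = gradient (F i) (u (ψ n)) := by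
  have hev : ∀ᶠ n in atTop, ∃ i, F i (u n) = f (u n) ∧ gradient f (u n) = gradient (F i) (u n) := by
    filter_upwards [hux.eventually_mem (isOpen_ball.mem_nhds hx)] with n hn
    obtain ⟨i, hi⟩ := hact _ (ball_subset_closedBall hn)
    refine ⟨i, hi, gradient_eq_of_eventuallyLE (hu n)
      ((hF i).differentiable (by norm_num) _) ?_ hi⟩
    filter_upwards [isOpen_ball.mem_nhds hn] with z hz
    exact hle z (ball_subset_closedBall hz) i
  obtain ⟨i, hi⟩ : ∃ i, ∃ᶠ n in atTop,
      F i (u n) = f (u n) ∧ gradient f (u n) = gradient (F i) (u n) := by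
    by_contra hcon
    simp only [not_exists, Filter.not_frequently] at hcon
    obtain ⟨n, h1, i, h2⟩ := ((eventually_all.2 hcon).and hev).exists
    exact h1 i h2
  exact ⟨i, Filter.extraction_of_frequently_atTop hi⟩

/-- Near `xbar`, limiting gradients of a maximum of finitely many smooth functions are gradients
of active functions. -/
lemma exists_eq_gradient_of_mem_limitingGradients (hF : ∀ i, ContDiff ℝ 2 (F i))
    (hle : ∀ z ∈ closedBall xbar ρ, ∀ i, F i z ≤ f z)
    (hact : ∀ z ∈ closedBall xbar ρ, ∃ i, F i z = f z)
    (hf : Continuous f) (hx : x ∈ ball xbar ρ) (hv : v ∈ limitingGradients f x) :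
    ∃ i, F i x = f x ∧ v = gradient (F i) x := by
  obtain ⟨u, hu, hux, huv⟩ := hv
  obtain ⟨i, ψ, hψ, hψi⟩ := exists_subseq_gradient_eq hF hle hact hx hu hux
  have huψ := hux.comp hψ.tendsto_atTop
  refine ⟨i, ?_, ?_⟩
  · exact tendsto_nhds_unique (((hF i).continuous.tendsto x).comp huψ)
      (((hf.tendsto x).comp huψ).congr fun n => (hψi n).1.symm)
  · exact tendsto_nhds_unique (huv.comp hψ.tendsto_atTop)
      ((((continuous_gradient (hF i)).tendsto x).comp huψ).congr fun n => (hψi n).2.symm)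

lemma nonempty_limitingGradients (hfL : LocallyLipschitz f) (hF : ∀ i, ContDiff ℝ 2 (F i))
    (hle : ∀ z ∈ closedBall xbar ρ, ∀ i, F i z ≤ f z)
    (hact : ∀ z ∈ closedBall xbar ρ, ∃ i, F i z = f z) (hx : x ∈ ball xbar ρ) :
    (limitingGradients f x).Nonempty := by
  obtain ⟨u, hu, hux⟩ := mem_closure_iff_seq_limit.1 (hfL.dense_differentiableAt x)
  obtain ⟨i, ψ, hψ, hψi⟩ := exists_subseq_gradient_eq hF hle hact hx hu hux
  have huψ := hux.comp hψ.tendsto_atTop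
  exact ⟨gradient (F i) x, u ∘ ψ, fun n => hu _, huψ,
    (((continuous_gradient (hF i)).tendsto x).comp huψ).congr fun n => (hψi n).2.symm⟩

lemma clarkeSubdiff_eq_convexHull (hF : ∀ i, ContDiff ℝ 2 (F i))
    (hle : ∀ z ∈ closedBall xbar ρ, ∀ i, F i z ≤ f z)
    (hact : ∀ z ∈ closedBall xbar ρ, ∃ i, F i z = f z)
    (hf : Continuous f) (hx : x ∈ ball xbar ρ) :
    clarkeSubdiff f x = convexHull ℝ (limitingGradients f x) := by
  have hfin : (limitingGradients f x).Finite := by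
    refine (finite_range fun i => gradient (F i) x).subset fun v hv => ?_
    obtain ⟨i, -, rfl⟩ := exists_eq_gradient_of_mem_limitingGradients hF hle hact hf hx hv
    exact mem_range_self i
  exact (hfin.isClosed_convexHull ℝ).closure_eq

lemma goldsteinSubdiff_eq_convexHull {ε : ℝ} (hF : ∀ i, ContDiff ℝ 2 (F i))
    (hle : ∀ z ∈ closedBall xbar ρ, ∀ i, F i z ≤ f z)
    (hact : ∀ z ∈ closedBall xbar ρ, ∃ i, F i z = f z)
    (hf : Continuous f) (hx : closedBall x ε ⊆ ball xbar ρ) :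
    goldsteinSubdiff f x ε = convexHull ℝ (⋃ z ∈ closedBall x ε, limitingGradients f z) := by
  refine Subset.antisymm (convexHull_min (iUnion₂_subset fun z hz => ?_) (convex_convexHull ℝ _))
    (convexHull_mono (iUnion₂_mono fun z hz => ?_))
  · rw [clarkeSubdiff_eq_convexHull hF hle hact hf (hx hz)]
    exact convexHull_mono (subset_iUnion₂_of_subset z hz Subset.rfl)
  · rw [clarkeSubdiff_eq_convexHull hF hle hact hf (hx hz)]
    exact subset_convexHull ℝ _

lemma isCompact_iUnion_limitingGradients {ε : ℝ} (hF : ∀ i, ContDiff ℝ 2 (F i))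
    (hle : ∀ z ∈ closedBall xbar ρ, ∀ i, F i z ≤ f z)
    (hact : ∀ z ∈ closedBall xbar ρ, ∃ i, F i z = f z)
    (hf : Continuous f) (hx : closedBall x ε ⊆ ball xbar ρ) :
    IsCompact (⋃ z ∈ closedBall x ε, limitingGradients f z) := by
  set K : Set E := ⋃ i, gradient (F i) '' closedBall x ε with hK
  have hKc : IsCompact K :=
    isCompact_iUnion fun i => (isCompact_closedBall x ε).image (continuous_gradient (hF i))
  have heq : (⋃ z ∈ closedBall x ε, limitingGradients f z) = Prod.snd ''
      ((closedBall x ε ×ˢ K) ∩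
        closure ((fun u => (u, gradient f u)) '' {u | DifferentiableAt ℝ f u})) := by
    ext v
    simp only [mem_iUnion₂, mem_image, mem_inter_iff, mem_prod, Prod.exists, exists_eq_right]
    constructor
    · rintro ⟨z, hz, hv⟩
      refine ⟨z, ⟨hz, ?_⟩, mem_limitingGradients_iff.1 hv⟩
      obtain ⟨i, -, rfl⟩ := exists_eq_gradient_of_mem_limitingGradients hF hle hact hf (hx hz) hv
      exact mem_iUnion.2 ⟨i, z, hz, rfl⟩
    · rintro ⟨z, ⟨hz, -⟩, hv⟩
      exact ⟨z, hz, mem_limitingGradients_iff.2 hv⟩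
  rw [heq]
  exact (((isCompact_closedBall x ε).prod hKc).inter_right isClosed_closure).image continuous_snd

end LimitingGradients

section Regularity

/-- Metric regularity of the equation `H y = 0` at points where the derivative is onto. -/
lemma HasStrictFDerivAt.exists_norm_sub_le_of_range_eq_top {V W : Type*} [NormedAddCommGroup V]
    [NormedSpace ℝ V] [CompleteSpace V] [NormedAddCommGroup W] [NormedSpace ℝ W] [CompleteSpace W]
    {H : V → W} {H' : V →L[ℝ] W} {a : V} (hH : HasStrictFDerivAt H H' a) (hsurj : H'.range = ⊤) :
    ∃ C > 0, ∃ R > 0, ∀ x, ‖x - a‖ ≤ R → ‖H x‖ ≤ R → ∃ y, H y = 0 ∧ ‖x - y‖ ≤ C * ‖H x‖ := by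
  let S := H'.nonlinearRightInverseOfSurjective hsurj
  have hS : 0 < S.nnnorm := H'.nonlinearRightInverseOfSurjective_nnnorm_pos hsurj
  have hS' : (0 : ℝ) < S.nnnorm := hS
  obtain ⟨s, hs, hHs⟩ := hH.approximates_deriv_on_nhds (c := S.nnnorm⁻¹ / 2)
    (Or.inr (by positivity))
  obtain ⟨r, hr, hrs⟩ := Metric.nhds_basis_closedBall.mem_iff.1 hs
  refine ⟨2 * S.nnnorm, by positivity, r / (1 + 2 * S.nnnorm), by positivity, fun x hx hHx => ?_⟩
  have hball : closedBall x (2 * S.nnnorm * ‖H x‖) ⊆ s := by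
    refine (closedBall_subset_closedBall' ?_).trans hrs
    rw [dist_eq_norm]
    calc 2 * S.nnnorm * ‖H x‖ + ‖x - a‖
        ≤ 2 * S.nnnorm * (r / (1 + 2 * S.nnnorm)) + r / (1 + 2 * S.nnnorm) := by gcongr
      _ = r := by field_simp; ring
  obtain ⟨y, hy, hy0⟩ := hHs.surjOn_closedBall_of_nonlinearRightInverse S (by positivity) hball
    (show (0 : W) ∈ _ by
      rw [mem_closedBall, dist_zero_left]
      refine le_of_eq ?_
      push_cast
      field_simp
      ring)
  exact ⟨y, hy0, by rwa [mem_closedBall, dist_comm, dist_eq_norm] at hy⟩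

lemma exists_infDist_le_of_affineIndependent {n : ℕ} {F : Fin (n + 1) → E → ℝ} {xbar : E}
    (hF : ∀ i, ContDiff ℝ 2 (F i)) (hind : AffineIndependent ℝ fun i => gradient (F i) xbar) :
    ∃ C > 0, ∃ R > 0, ∀ x, ‖x - xbar‖ ≤ R → ∀ η, 0 ≤ η → η ≤ R →
      (∀ i, |F i x - F 0 x| ≤ η) →
        Metric.infDist x {y : E | ∀ i j, F i y = F j y} ≤ C * η := by
  let H : E → Fin n → ℝ := fun x i => F i.succ x - F 0 x
  let H' : E →L[ℝ] Fin n → ℝ :=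
    ContinuousLinearMap.pi fun i => fderiv ℝ (F i.succ) xbar - fderiv ℝ (F 0) xbar
  have hH : HasStrictFDerivAt H H' xbar := by
    refine hasStrictFDerivAt_pi.2 fun i => ?_
    exact ((hF i.succ).contDiffAt.hasStrictFDerivAt (by norm_num)).sub
      ((hF 0).contDiffAt.hasStrictFDerivAt (by norm_num))
  have hsurj : H'.range = ⊤ := by
    by_contra hne
    obtain ⟨φ, hφ0, hφ⟩ := Submodule.exists_le_ker_of_lt_top _ (lt_top_iff_ne_top.2 hne)
    let a : Fin n → ℝ := fun i => φ (Pi.single i 1)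
    have hφa : ∀ t : Fin n → ℝ, φ t = ∑ i, t i * a i := fun t => by
      conv_lhs => rw [← Finset.univ_sum_single t]
      rw [map_sum]
      refine Finset.sum_congr rfl fun i _ => ?_
      rw [← smul_eq_mul, ← map_smul, ← Pi.single_smul, smul_eq_mul, mul_one]
    let b : Fin (n + 1) → ℝ := Fin.cons (-∑ i, a i) a
    have hb : ∀ i, b i = 0 := by
      refine fun i => (affineIndependent_iff.1 hind) Finset.univ b ?_ ?_ i (Finset.mem_univ i)
      · rw [Fin.sum_univ_succ]
        exact neg_add_cancel _
      · refine ext_inner_right ℝ fun v => ?_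
        have hv : φ (H' v) = 0 := hφ ⟨v, rfl⟩
        rw [hφa] at hv
        rw [Fin.sum_univ_succ, inner_add_left, sum_inner, inner_zero_left, ← hv]
        simp only [b, Fin.cons_zero, Fin.cons_succ, real_inner_smul_left, inner_gradient_left, H',
          ContinuousLinearMap.pi_apply, sub_apply, sub_mul,
          Finset.sum_sub_distrib, neg_mul, Finset.sum_mul]
        simp only [mul_comm]
        ring
    refine hφ0 (LinearMap.ext fun t => ?_)
    rw [hφa]
    exact Finset.sum_eq_zero fun i _ => by rw [show a i = b i.succ from rfl, hb, mul_zero]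
  obtain ⟨C, hC, R, hR, h⟩ := hH.exists_norm_sub_le_of_range_eq_top hsurj
  refine ⟨C, hC, R, hR, fun x hx η hη0 hηR hη => ?_⟩
  have hHx : ‖H x‖ ≤ η := (pi_norm_le_iff_of_nonneg hη0).2 fun i => hη i.succ
  obtain ⟨y, hy, hxy⟩ := h x hx (hHx.trans hηR)
  have hy0 : ∀ i, F i y = F 0 y := fun i => by
    refine Fin.cases rfl (fun k => ?_) i
    exact sub_eq_zero.1 (congrFun hy k)
  have hyM : y ∈ {y : E | ∀ i j, F i y = F j y} := fun i j => (hy0 i).trans (hy0 j).symm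
  refine (Metric.infDist_le_dist_of_mem hyM).trans ?_
  rw [dist_eq_norm]
  exact hxy.trans (mul_le_mul_of_nonneg_left hHx hC.le)

lemma exists_lipschitz_bound {ι : Type*} [Fintype ι] {F : ι → E → ℝ}
    (hF : ∀ i, ContDiff ℝ 2 (F i)) (a : E) (r : ℝ) :
    ∃ L > 0, ∀ i, ∀ x ∈ closedBall a r, ∀ y ∈ closedBall a r,
      |F i x - F i y| ≤ L * ‖x - y‖ ∧ ‖gradient (F i) x - gradient (F i) y‖ ≤ L * ‖x - y‖ := by
  have h1 : ∀ i, ∃ K, LipschitzOnWith K (F i) (closedBall a r) := fun i =>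
    LocallyLipschitzOn.exists_lipschitzOnWith_of_compact (isCompact_closedBall a r)
      ((hF i).of_le (by norm_num)).locallyLipschitz.locallyLipschitzOn
  have h2 : ∀ i, ∃ K, LipschitzOnWith K (gradient (F i)) (closedBall a r) := fun i => by
    refine LocallyLipschitzOn.exists_lipschitzOnWith_of_compact (isCompact_closedBall a r)
      (ContDiff.locallyLipschitz (𝕂 := ℝ) ?_).locallyLipschitzOn
    exact (InnerProductSpace.toDual ℝ E).symm.contDiff.comp
      ((hF i).fderiv_right (m := 1) (by norm_num))
  choose K hK using h1
  choose K' hK' using h2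
  refine ⟨∑ i, ((K i : ℝ) + K' i) + 1, by positivity, fun i x hx y hy => ?_⟩
  have hle : (K i : ℝ) + K' i ≤ ∑ i, ((K i : ℝ) + K' i) :=
    Finset.single_le_sum (f := fun i => (K i : ℝ) + K' i) (fun i _ => by positivity)
      (Finset.mem_univ i)
  have hk := (K i).coe_nonneg
  have hk' := (K' i).coe_nonneg
  constructor
  · have := (hK i).dist_le_mul x hx y hy
    rw [Real.dist_eq, dist_eq_norm] at this
    exact this.trans (mul_le_mul_of_nonneg_right (by linarith) (norm_nonneg _))
  · have := (hK' i).dist_le_mul x hx y hy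
    rw [dist_eq_norm, dist_eq_norm] at this
    exact this.trans (mul_le_mul_of_nonneg_right (by linarith) (norm_nonneg _))

end Regularity

section GoldsteinGradient

variable {ι : Type*} {f : E → ℝ} {F : ι → E → ℝ} {xbar x : E} {ρ ε : ℝ}

lemma goldsteinGrad_spec [Fintype ι] (hfL : LocallyLipschitz f) (hF : ∀ i, ContDiff ℝ 2 (F i))
    (hle : ∀ z ∈ closedBall xbar ρ, ∀ i, F i z ≤ f z)
    (hact : ∀ z ∈ closedBall xbar ρ, ∃ i, F i z = f z) (hε : 0 ≤ ε)
    (hx : closedBall x ε ⊆ ball xbar ρ) :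
    goldsteinGrad f x ε ∈ goldsteinSubdiff f x ε ∧
      ∀ v ∈ goldsteinSubdiff f x ε, ‖goldsteinGrad f x ε‖ ≤ ‖v‖ := by
  refine minNorm_spec ?_ ?_ <;>
    rw [goldsteinSubdiff_eq_convexHull hF hle hact hfL.continuous hx]
  · exact (isCompact_iUnion_limitingGradients hF hle hact hfL.continuous
      hx).convexHull_of_finiteDimensional
  · have hmem := mem_closedBall_self (x := x) hε
    obtain ⟨v, hv⟩ := nonempty_limitingGradients hfL hF hle hact (hx hmem)
    exact ⟨v, subset_convexHull ℝ _ (mem_iUnion₂.2 ⟨x, hmem, hv⟩)⟩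

/-- The gradients at points of a ball of the functions active there which are limiting gradients
of `f`. -/
def activeGradients (f : E → ℝ) (F : ι → E → ℝ) (x : E) (ε : ℝ) (i : ι) : Set E :=
  {v | ∃ z ∈ closedBall x ε, F i z = f z ∧ v = gradient (F i) z ∧ v ∈ limitingGradients f z}

lemma goldsteinSubdiff_eq_convexHull_activeGradients [Fintype ι] (hF : ∀ i, ContDiff ℝ 2 (F i))
    (hle : ∀ z ∈ closedBall xbar ρ, ∀ i, F i z ≤ f z)
    (hact : ∀ z ∈ closedBall xbar ρ, ∃ i, F i z = f z)
    (hf : Continuous f) (hx : closedBall x ε ⊆ ball xbar ρ) :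
    goldsteinSubdiff f x ε = convexHull ℝ (⋃ i, activeGradients f F x ε i) := by
  rw [goldsteinSubdiff_eq_convexHull hF hle hact hf hx]
  congr 1
  ext v
  simp only [mem_iUnion]
  constructor
  · rintro ⟨z, hz, hv⟩
    obtain ⟨i, hi, hvi⟩ := exists_eq_gradient_of_mem_limitingGradients hF hle hact hf (hx hz) hv
    exact ⟨i, z, hz, hi, hvi, hv⟩
  · rintro ⟨i, z, hz, -, -, hv⟩
    exact ⟨z, hz, hv⟩

lemma norm_sub_le_of_mem_convexHull_activeGradients {i : ι} {w v : E} {η : ℝ}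
    (hw : ∀ z ∈ closedBall x ε, ‖gradient (F i) z - w‖ ≤ η)
    (hv : v ∈ convexHull ℝ (activeGradients f F x ε i)) : ‖v - w‖ ≤ η := by
  rw [← dist_eq_norm, ← mem_closedBall]
  refine convexHull_min ?_ (convex_closedBall w η) hv
  rintro _ ⟨z, hz, -, rfl, -⟩
  rw [mem_closedBall, dist_eq_norm]
  exact hw z hz

end GoldsteinGradient

theorem stmt16 (f : E → ℝ) (hf : LocallyLipschitz f) (xbar : E) {n : ℕ}
    (F : Fin (n + 1) → E → ℝ) (hF : IsStrongC2MaxAt f xbar F) :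
    ∃ μ > 0, ∃ C > 0, ∃ δ > 0, ∃ epsbar > 0,
      ∀ x : E, ‖x - xbar‖ ≤ δ → ∀ ε : ℝ, 0 ≤ ε → ε ≤ epsbar →
        ‖goldsteinGrad f x ε‖ ≤ μ →
        Metric.infDist x {y : E | ∀ i j, F i y = F j y} ≤ C * ε ∧
        ∀ y : E, (∀ i j, F i y = F j y) →
          ‖x - y‖ = Metric.infDist x {y : E | ∀ i j, F i y = F j y} →
          ‖goldsteinGrad f x ε -
              minNorm (convexHull ℝ (Set.range fun i => gradient (F i) y))‖ ≤ C * ε := by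
  obtain ⟨hC2, ⟨ρ, hρ, hmax⟩, -, hind, hri, -⟩ := hF
  have hle : ∀ z ∈ closedBall xbar ρ, ∀ i, F i z ≤ f z := fun z hz i => by
    rw [hmax z (mem_closedBall_iff_norm.1 hz)]
    exact Finset.le_sup' (fun i => F i z) (Finset.mem_univ i)
  have hact : ∀ z ∈ closedBall xbar ρ, ∃ i, F i z = f z := fun z hz => by
    obtain ⟨i, -, hi⟩ := Finset.exists_mem_eq_sup' Finset.univ_nonempty fun i => F i z
    exact ⟨i, by rw [hmax z (mem_closedBall_iff_norm.1 hz), hi]⟩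
  obtain ⟨l, hl0, hl1, hlw⟩ := exists_pos_weights_of_mem_intrinsicInterior hri
  obtain ⟨i₀, hi₀⟩ := Finite.exists_min l
  obtain ⟨l₀, hl₀, hl₀l⟩ : ∃ l₀ > 0, ∀ i, l₀ ≤ l i := ⟨l i₀, hl0 i₀, hi₀⟩
  obtain ⟨c, hc, hcw⟩ := hind.exists_le_norm_sum_smul
  obtain ⟨L, hL, hLip⟩ := exists_lipschitz_bound hC2 xbar 1
  obtain ⟨C₀, hC₀, R, hR, hreg⟩ := exists_infDist_le_of_affineIndependent hC2 hind
  obtain ⟨η₀, hη₀, hη₀c, hη₀l⟩ : ∃ η₀ > 0, η₀ < c ∧ 2 * η₀ < (c - η₀) * l₀ := by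
    refine ⟨c * l₀ / (2 * (2 + l₀)), by positivity, ?_, ?_⟩
    · rw [div_lt_iff₀ (by positivity)]; nlinarith [mul_pos hc hl₀]
    · have : c * l₀ / (2 * (2 + l₀)) * (2 + l₀) = c * l₀ / 2 := by field_simp
      nlinarith [mul_pos hc hl₀]
  have hpos : ∀ (w : Fin (n + 1) → E) (m : Fin (n + 1) → ℝ),
      (∀ i, ‖w i - gradient (F i) xbar‖ ≤ η₀) → (∀ i, 0 ≤ m i) → ∑ i, m i = 1 →
      ‖∑ i, m i • w i‖ ≤ η₀ → ∀ i, 0 < m i := by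
    intro w m hw hm0 hm1 hmw j
    refine (hm0 j).lt_of_ne' fun hmj => ?_
    have h1 := le_norm_sum_smul_of_weight_eq_zero hcw hw hη₀c.le (fun i => (hl0 i).le) hl1 hlw
      hm1 hmj
    have h2 := mul_le_mul_of_nonneg_left (hl₀l j) (sub_pos.2 hη₀c).le
    linarith
  obtain ⟨r, hr, hr1, hrρ, hrL⟩ : ∃ r > 0, r ≤ 1 ∧ r < ρ ∧ L * r ≤ η₀ := by
    refine ⟨min 1 (min (ρ / 2) (η₀ / L)), by positivity, min_le_left _ _, ?_, ?_⟩
    · exact ((min_le_right _ _).trans (min_le_left _ _)).trans_lt (by linarith)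
    · rw [mul_comm, ← le_div_iff₀ hL]
      exact (min_le_right _ _).trans (min_le_right _ _)
  have hgrad : ∀ i, ∀ z, ‖z - xbar‖ ≤ r → ‖gradient (F i) z - gradient (F i) xbar‖ ≤ η₀ := by
    intro i z hz
    refine ((hLip i z (mem_closedBall_iff_norm.2 (hz.trans hr1)) xbar
      (mem_closedBall_self zero_le_one)).2).trans (le_trans ?_ hrL)
    gcongr
  set C₁ : ℝ := C₀ * (2 * L) with hC₁
  have hC₁0 : 0 < C₁ := by positivity
  set C₂ : ℝ := (2 + η₀ / (c - η₀)) * (L * (1 + C₁)) with hC₂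
  have hcη : 0 < c - η₀ := sub_pos.2 hη₀c
  have hC₂0 : 0 < C₂ := by positivity
  refine ⟨η₀, hη₀, C₁ + C₂, by positivity, min (r / 2) R, by positivity,
    min (r / 2) (min (R / (2 * L)) (r / 2 / C₁)), by positivity, ?_⟩
  intro x hx ε hε0 hε hg
  have hxr : ‖x - xbar‖ ≤ r / 2 := hx.trans (min_le_left _ _)
  have hεr : ε ≤ r / 2 := hε.trans (min_le_left _ _)
  have hεR : 2 * L * ε ≤ R := by
    rw [mul_comm, ← le_div_iff₀ (by positivity)]
    exact hε.trans ((min_le_right _ _).trans (min_le_left _ _))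
  have hεC : C₁ * ε ≤ r / 2 := by
    rw [mul_comm, ← le_div_iff₀ hC₁0]
    exact hε.trans ((min_le_right _ _).trans (min_le_right _ _))
  have hzr : ∀ z ∈ closedBall x ε, ‖z - xbar‖ ≤ r := fun z hz => by
    have h1 := norm_sub_le_norm_sub_add_norm_sub z x xbar
    have h2 := mem_closedBall_iff_norm.1 hz
    linarith
  have hball : closedBall x ε ⊆ ball xbar ρ := fun z hz =>
    mem_ball_iff_norm.2 ((hzr z hz).trans_lt hrρ)
  obtain ⟨hgmem, hgmin⟩ := goldsteinGrad_spec hf hC2 hle hact hε0 hball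
  have hG := goldsteinSubdiff_eq_convexHull_activeGradients hC2 hle hact hf.continuous hball
  set g := goldsteinGrad f x ε with hgdef
  rw [hG] at hgmem hgmin
  obtain ⟨m, u, hm0, hm1, hu, hmu⟩ := exists_weights_of_mem_convexHull_iUnion hgmem
  have hm : ∀ i, 0 < m i := by
    refine hpos (fun i => if 0 < m i then u i else gradient (F i) xbar) m (fun i => ?_) hm0 hm1 ?_
    · split_ifs with h
      · exact norm_sub_le_of_mem_convexHull_activeGradients (fun z hz => hgrad i z (hzr z hz))
          (hu i h)
      · simpa using hη₀.le
    · refine le_trans (le_of_eq ?_) hg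
      rw [← hmu]
      congr 1
      refine Finset.sum_congr rfl fun i _ => ?_
      split_ifs with h
      · rfl
      · rw [le_antisymm (not_lt.1 h) (hm0 i), zero_smul, zero_smul]
  replace hu := fun i => hu i (hm i)
  have hx1 : x ∈ closedBall xbar 1 := mem_closedBall_iff_norm.2 (by linarith)
  have hclose : ∀ i j, F j x - F i x ≤ 2 * L * ε := by
    intro i j
    obtain ⟨_, z, hz, hiz, -⟩ := convexHull_nonempty_iff.1 ⟨u i, hu i⟩
    have hz1 : z ∈ closedBall xbar 1 := mem_closedBall_iff_norm.2 ((hzr z hz).trans hr1)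
    have hxz : L * ‖x - z‖ ≤ L * ε := by
      rw [norm_sub_rev]
      exact mul_le_mul_of_nonneg_left (mem_closedBall_iff_norm.1 hz) hL.le
    have h1 := abs_le.1 ((hLip i x hx1 z hz1).1)
    have h2 := abs_le.1 ((hLip j x hx1 z hz1).1)
    have h3 := hle z (ball_subset_closedBall (hball hz)) j
    linarith [h1.1, h2.2]
  have hdist : Metric.infDist x {y : E | ∀ i j, F i y = F j y} ≤ C₁ * ε := by
    rw [hC₁, mul_assoc]
    refine hreg x (hx.trans (min_le_right _ _)) (2 * L * ε) (by positivity) hεR fun i => ?_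
    exact abs_le.2 ⟨by linarith [hclose i 0], hclose 0 i⟩
  refine ⟨hdist.trans (mul_le_mul_of_nonneg_right (by linarith) hε0), fun y hy hxy => ?_⟩
  rw [← hxy] at hdist
  have hyr : ‖y - xbar‖ ≤ r := by
    have h1 := norm_sub_le_norm_sub_add_norm_sub y x xbar
    rw [norm_sub_rev y x] at h1
    linarith
  have hy1 : y ∈ closedBall xbar 1 := mem_closedBall_iff_norm.2 (hyr.trans hr1)
  have hwbar := fun i => hgrad i y hyr
  have huy : ∀ i, ‖u i - gradient (F i) y‖ ≤ L * (1 + C₁) * ε := fun i => by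
    refine norm_sub_le_of_mem_convexHull_activeGradients (fun z hz => ?_) (hu i)
    have hz1 : z ∈ closedBall xbar 1 := mem_closedBall_iff_norm.2 ((hzr z hz).trans hr1)
    refine ((hLip i z hz1 y hy1).2).trans ?_
    rw [mul_assoc]
    refine mul_le_mul_of_nonneg_left ?_ hL.le
    have h1 := norm_sub_le_norm_sub_add_norm_sub z x y
    have h2 := mem_closedBall_iff_norm.1 hz
    linarith
  obtain ⟨hpmem, hpmin⟩ := minNorm_spec
    ((finite_range fun i => gradient (F i) y).isCompact_convexHull ℝ)
    (convexHull_nonempty_iff.2 (range_nonempty _))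
  set p := minNorm (convexHull ℝ (Set.range fun i => gradient (F i) y)) with hpdef
  obtain ⟨k, hk0, hk1, hkp⟩ := mem_convexHull_range_iff.1 hpmem
  have hpη : ‖p‖ ≤ η₀ := by
    refine (hpmin _ (mem_convexHull_range_iff.2 ⟨l, fun i => (hl0 i).le, hl1, rfl⟩)).trans ?_
    have h := norm_sum_smul_le_mul_sum_abs hwbar l
    simp only [abs_of_pos (hl0 _), hl1, mul_one, smul_sub, Finset.sum_sub_distrib, hlw,
      sub_zero] at h
    exact h
  have hk := hpos _ k hwbar hk0 hk1 (by rw [hkp]; exact hpη)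
  have hpw := inner_eq_of_norm_le (convex_convexHull ℝ _) hpmem hpmin
    (fun i => subset_convexHull ℝ _ (mem_range_self i)) hk hk1 hkp
  have hgu := inner_eq_of_norm_le (convex_convexHull ℝ _) hgmem hgmin
    (fun i => convexHull_mono (subset_iUnion _ i) (hu i)) hm hm1 hmu
  have hfin := norm_sub_le_of_inner_eq hcη (le_norm_sum_smul_of_norm_sub_le hcw hwbar) huy
    (by positivity) hk1 hm0 hm1 hmu hkp hgu hpw
  calc ‖g - p‖ ≤ (2 + ‖g‖ / (c - η₀)) * (L * (1 + C₁) * ε) := hfin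
    _ ≤ (2 + η₀ / (c - η₀)) * (L * (1 + C₁) * ε) := by gcongr
    _ = C₂ * ε := by rw [hC₂]; ring
    _ ≤ (C₁ + C₂) * ε := mul_le_mul_of_nonneg_right (by linarith) hε0
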